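/- Let N, k, ℓ, n be integers with 0 ≤ n ≤ ℓ ≤ N and 0 ≤ k − n ≤ N − ℓ, and set Ω = {1,…,N} \ {1,…,ℓ}. Then in K: Σ_{m'=0}^{N−k−ℓ+n} (q^{-m'}/(t^{k−N+1}q^{-1};t)_{m'+ℓ−n}) · Σ_{J ⊆ Ω, |J| = k−n} x_J Σ_{J' ⊆ Ω∖J, |J'| = m'} Ã_{J∪J'}^{Ω} = (1/(q^{-1};t^{-1})_{N−k}) · Σ_{J ⊆ Ω, |J| = k−n} x_J. -/

import Mathlib

open Finset MvPolynomial

set_option synthInstance.maxHeartbeats 1000000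
set_option maxHeartbeats 1000000

noncomputable section

/-- The field ℚ(q,t): fraction field of ℚ[q,t] (variables indexed by `Bool`). -/
abbrev Fqt : Type := FractionRing (MvPolynomial Bool ℚ)

/-- The polynomial ring ℚ(q,t)[x₁,…,x_N]. -/
abbrev Rx (N : ℕ) : Type := MvPolynomial (Fin N) Fqt

/-- The field K = ℚ(q,t,x₁,…,x_N), realized as the fraction field of ℚ(q,t)[x₁,…,x_N]. -/
abbrev K (N : ℕ) : Type := FractionRing (Rx N)

/-- The indeterminate q, as an element of K. -/
def qK (N : ℕ) : K N :=
  algebraMap (Rx N) (K N) (C (algebraMap (MvPolynomial Bool ℚ) Fqt (X true)))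

/-- The indeterminate t, as an element of K. -/
def tK (N : ℕ) : K N :=
  algebraMap (Rx N) (K N) (C (algebraMap (MvPolynomial Bool ℚ) Fqt (X false)))

/-- The indeterminate x_i, as an element of K. -/
def xK {N : ℕ} (i : Fin N) : K N := algebraMap (Rx N) (K N) (X i)

/-- The q-Pochhammer symbol (a;b)_n = ∏_{i=0}^{n-1} (1 - a·bⁱ). -/
def poch {F : Type*} [Field F] (a b : F) (n : ℕ) : F :=
  ∏ i ∈ Finset.range n, (1 - a * b ^ i)

/-- x_I = ∏_{i ∈ I} x_i. -/
def xProd {N : ℕ} (I : Finset (Fin N)) : K N := ∏ i ∈ I, xK i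

/-- Ã_I^J = ∏_{i ∈ I, j ∈ J∖I} (x_i − t⁻¹x_j)/(x_i − x_j). -/
def Atilde {N : ℕ} (I J : Finset (Fin N)) : K N :=
  ∏ i ∈ I, ∏ j ∈ J \ I, (xK i - (tK N)⁻¹ * xK j) / (xK i - xK j)


/-- The set {1,…,N} ∖ {1,…,ℓ}, i.e. the last N − ℓ of the N variable indices. -/
def highSet (N ℓ : ℕ) : Finset (Fin N) := Finset.univ.filter fun i => ℓ ≤ (i : ℕ)

/-- The set {1,…,ℓ}, i.e. the first ℓ of the N variable indices. -/
def lowSet (N ℓ : ℕ) : Finset (Fin N) := Finset.univ.filter fun i => (i : ℕ) < ℓ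

/-- Shortcut instance to speed up typeclass search on K. -/
noncomputable instance instKField (N : ℕ) : Field (K N) := inferInstance

section Symmetrization

variable {ι F : Type*} [Field F]

/-- The elementary symmetric polynomial of degree `r` in the `x i`, `i ∈ I`. -/
def elemSymm (x : ι → F) (r : ℕ) (I : Finset ι) : F :=
  ∑ J ∈ powersetCard r I, ∏ i ∈ J, x i

/-- The factor `(x i - s * x j) / (x i - x j)`. -/
def hlFactor (x : ι → F) (s : F) (i j : ι) : F := (x i - s * x j) / (x i - x j)

/-- The `s`-integer `1 + s + ⋯ + s ^ (n - 1)`. -/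
def sInt (s : F) (n : ℕ) : F := ∑ i ∈ range n, s ^ i

/-- The `s`-factorial. -/
def sFactorial (s : F) (n : ℕ) : F := ∏ i ∈ range n, sInt s (i + 1)

/-- The Gaussian binomial coefficient with base `s`. -/
def sChoose (s : F) (m j : ℕ) : F :=
  if j ≤ m then sFactorial s m / (sFactorial s j * sFactorial s (m - j)) else 0

theorem sInt_add (s : F) (a b : ℕ) : sInt s (a + b) = sInt s a + s ^ a * sInt s b := by
  simp only [sInt, sum_range_add, mul_sum, pow_add]

theorem sFactorial_succ (s : F) (n : ℕ) :
    sFactorial s (n + 1) = sFactorial s n * sInt s (n + 1) := prod_range_succ _ _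

theorem sFactorial_ne_zero {s : F} (hs : ∀ n, sInt s (n + 1) ≠ 0) (n : ℕ) :
    sFactorial s n ≠ 0 := prod_ne_zero_iff.2 fun i _ => hs i

theorem sChoose_zero_right {s : F} (hs : ∀ n, sInt s (n + 1) ≠ 0) (m : ℕ) :
    sChoose s m 0 = 1 := by
  have := sFactorial_ne_zero hs m
  simp [sChoose, this, show sFactorial s 0 = 1 from prod_range_zero _]

theorem sInt_mul_sChoose {s : F} (hs : ∀ n, sInt s (n + 1) ≠ 0) (m j : ℕ) :
    sInt s (j + 1) * sChoose s (m + 1) (j + 1) = sInt s (m + 1) * sChoose s m j := by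
  unfold sChoose
  split_ifs with h1 h2 h2
  · have := hs j
    have := sFactorial_ne_zero hs j
    have := sFactorial_ne_zero hs (m - j)
    rw [Nat.add_sub_add_right, sFactorial_succ, sFactorial_succ]
    field_simp
  · omega
  · omega
  · simp

theorem sChoose_succ_succ {s : F} (hs : ∀ n, sInt s (n + 1) ≠ 0) {m j : ℕ} (h : j ≤ m) :
    sChoose s (m + 1) (j + 1) = s ^ (m - j) * sChoose s m j + sChoose s m (j + 1) := by
  obtain ⟨a, rfl⟩ := Nat.exists_eq_add_of_le h
  have hj := sFactorial_ne_zero hs j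
  have ha := sFactorial_ne_zero hs a
  have hj1 := hs j
  rcases a with _ | a
  · have := sFactorial_ne_zero hs (j + 1)
    simp [sChoose, sFactorial_ne_zero hs, show sFactorial s 0 = 1 from prod_range_zero _]
  · have h0 := sFactorial_ne_zero hs a
    have ha1 := hs a
    have e : sInt s (j + (a + 1) + 1) = sInt s (a + 1) + s ^ (a + 1) * sInt s (j + 1) := by
      rw [← sInt_add]; congr 1; omega
    rw [sChoose, sChoose, sChoose, if_pos (by omega), if_pos (by omega), if_pos (by omega),
      show j + (a + 1) + 1 - (j + 1) = a + 1 by omega, show j + (a + 1) - j = a + 1 by omega,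
      show j + (a + 1) - (j + 1) = a by omega, sFactorial_succ s (j + (a + 1)), e,
      sFactorial_succ s j, sFactorial_succ s a]
    field_simp
    ring

theorem sum_pow_mul_poch_mul_sChoose {s : F} (hs : ∀ n, sInt s (n + 1) ≠ 0) (Q : F) (m : ℕ) :
    ∑ j ∈ range (m + 1), Q ^ j * poch Q s (m - j) * sChoose s m j = 1 := by
  induction m with
  | zero => simp [poch, sChoose, sFactorial]
  | succ m ih =>
    rw [sum_range_succ']
    have hstep : ∀ j ∈ range (m + 1),
        Q ^ (j + 1) * poch Q s (m + 1 - (j + 1)) * sChoose s (m + 1) (j + 1) =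
          Q * s ^ (m - j) * (Q ^ j * poch Q s (m - j) * sChoose s m j) +
            Q ^ (j + 1) * poch Q s (m + 1 - (j + 1)) * sChoose s m (j + 1) := by
      intro j hj
      rw [sChoose_succ_succ hs (by simp at hj; omega), Nat.add_sub_add_right]
      ring
    have hlast : sChoose s m (m + 1) = 0 := by simp [sChoose]
    rw [sum_congr rfl hstep, sum_add_distrib, add_assoc, sChoose_zero_right hs,
      ← sChoose_zero_right hs m,
      ← sum_range_succ' (fun j => Q ^ j * poch Q s (m + 1 - j) * sChoose s m j),
      sum_range_succ _ (m + 1), hlast, mul_zero, add_zero, ← sum_add_distrib,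
      sChoose_zero_right hs, ← ih]
    refine sum_congr rfl fun j hj => ?_
    have : m + 1 - j = m - j + 1 := by simp at hj; omega
    rw [this, poch, poch, prod_range_succ]
    ring

theorem elemSymm_zero (x : ι → F) (I : Finset ι) : elemSymm x 0 I = 1 := by
  simp [elemSymm]

theorem elemSymm_card (x : ι → F) (I : Finset ι) : elemSymm x #I I = ∏ i ∈ I, x i := by
  simp [elemSymm]

theorem elemSymm_of_card_lt (x : ι → F) {r : ℕ} {I : Finset ι} (h : #I < r) :
    elemSymm x r I = 0 := by
  rw [elemSymm, powersetCard_eq_empty.2 h, sum_empty]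

variable [DecidableEq ι]

/-- The coefficient `∏ (x i - s * x j) / (x i - x j)` over `i ∈ I`, `j ∈ J \ I`. -/
def hlCoeff (x : ι → F) (s : F) (I J : Finset ι) : F :=
  ∏ i ∈ I, ∏ j ∈ J \ I, hlFactor x s i j

theorem elemSymm_succ_insert (x : ι → F) (r : ℕ) {a : ι} {I : Finset ι} (ha : a ∉ I) :
    elemSymm x (r + 1) (insert a I) = elemSymm x (r + 1) I + x a * elemSymm x r I := by
  unfold elemSymm
  rw [powersetCard_succ_insert ha, sum_union, sum_image, mul_sum]
  · congr 1
    refine sum_congr rfl fun J hJ => ?_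
    rw [prod_insert fun h => ha ((mem_powersetCard.1 hJ).1 h)]
  · intro J hJ J' hJ' h
    have h1 : a ∉ J := fun h => ha ((mem_powersetCard.1 hJ).1 h)
    have h2 : a ∉ J' := fun h => ha ((mem_powersetCard.1 hJ').1 h)
    rw [← erase_insert h1, ← erase_insert h2, h]
  · rw [disjoint_left]
    intro J hJ hJ'
    obtain ⟨J', -, rfl⟩ := mem_image.1 hJ'
    exact ha ((mem_powersetCard.1 hJ).1 (mem_insert_self _ _))

theorem elemSymm_succ_erase (x : ι → F) (r : ℕ) {a : ι} {I : Finset ι} (ha : a ∈ I) :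
    elemSymm x (r + 1) I = elemSymm x (r + 1) (I.erase a) + x a * elemSymm x r (I.erase a) := by
  rw [← elemSymm_succ_insert x r (notMem_erase a I), insert_erase ha]

theorem hlCoeff_singleton (x : ι → F) (s : F) (a : ι) (Ω : Finset ι) :
    hlCoeff x s {a} Ω = ∏ j ∈ Ω.erase a, hlFactor x s a j := by
  simp [hlCoeff, sdiff_singleton_eq_erase]

theorem sum_hlCoeff_mul_prod_X_add_C {x : ι → F} {Ω : Finset ι} (hx : Set.InjOn x Ω) (s : F) :
    ∑ a ∈ Ω, Polynomial.C ((1 - s) * x a * hlCoeff x s {a} Ω) *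
        ∏ j ∈ Ω.erase a, (Polynomial.X + Polynomial.C (x j)) =
      ∏ j ∈ Ω, (Polynomial.X + Polynomial.C (x j)) -
        ∏ j ∈ Ω, (Polynomial.X + Polynomial.C (s * x j)) := by
  have hmonic : ∀ (y : ι → F) (I : Finset ι),
      (∏ j ∈ I, (Polynomial.X + Polynomial.C (y j))).Monic :=
    fun y I => Polynomial.monic_prod_of_monic _ _ fun j _ => Polynomial.monic_X_add_C (y j)
  have hdeg : ∀ (y : ι → F) (I : Finset ι),
      (∏ j ∈ I, (Polynomial.X + Polynomial.C (y j))).degree = (#I : WithBot ℕ) := by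
    intro y I
    rw [Polynomial.degree_prod]
    simp
  refine Polynomial.eq_of_degrees_lt_of_eval_index_eq (v := fun i => - x i) Ω ?_ ?_ ?_ ?_
  · intro a ha b hb h
    exact hx ha hb (neg_injective h)
  · refine (Polynomial.degree_sum_le _ _).trans_lt ((Finset.sup_lt_iff (WithBot.bot_lt_coe _)).2 ?_)
    intro a ha
    refine (Polynomial.degree_mul_le _ _).trans_lt ?_
    rw [hdeg]
    refine (add_le_add_left Polynomial.degree_C_le _).trans_lt ?_
    rw [zero_add]
    exact_mod_cast card_erase_lt_of_mem ha
  · rw [← hdeg x Ω]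
    exact Polynomial.degree_sub_lt_left (by rw [hdeg, hdeg]) (hmonic x Ω).ne_zero
      (by rw [(hmonic _ _).leadingCoeff, (hmonic _ _).leadingCoeff])
  · intro b hb
    rw [Polynomial.eval_finsetSum, sum_eq_single_of_mem b hb]
    · simp only [Polynomial.eval_mul, Polynomial.eval_sub, Polynomial.eval_prod,
        Polynomial.eval_add, Polynomial.eval_X, Polynomial.eval_C]
      rw [prod_eq_zero hb (neg_add_cancel _), ← mul_prod_erase Ω _ hb, hlCoeff_singleton,
        mul_assoc, ← prod_mul_distrib]
      have : ∀ j ∈ Ω.erase b, hlFactor x s b j * (-x b + x j) = -x b + s * x j := by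
        intro j hj
        have : x b - x j ≠ 0 := sub_ne_zero.2 fun h =>
          ne_of_mem_erase hj (hx hb (mem_of_mem_erase hj) h).symm
        rw [hlFactor]
        field_simp
        ring
      rw [prod_congr rfl this]
      ring
    · intro a _ hab
      rw [Polynomial.eval_mul, Polynomial.eval_prod,
        prod_eq_zero (mem_erase.2 ⟨hab.symm, hb⟩) (by simp), mul_zero]

theorem sum_hlCoeff_mul_elemSymm_erase {x : ι → F} {Ω : Finset ι} (hx : Set.InjOn x Ω) {s : F}
    (hs : s ≠ 1) (r : ℕ) :
    ∑ a ∈ Ω, hlCoeff x s {a} Ω * (x a * elemSymm x r (Ω.erase a)) =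
      sInt s (r + 1) * elemSymm x (r + 1) Ω := by
  have hs' : 1 - s ≠ 0 := sub_ne_zero.2 hs.symm
  rcases lt_or_ge r #Ω with hr | hr
  · have h := congrArg (fun p => p.coeff (#Ω - (r + 1))) (sum_hlCoeff_mul_prod_X_add_C hx s)
    simp only [Polynomial.finsetSum_coeff, Polynomial.coeff_C_mul, Polynomial.coeff_sub] at h
    rw [Finset.prod_X_add_C_coeff _ _ (by omega), Finset.prod_X_add_C_coeff _ _ (by omega),
      show #Ω - (#Ω - (r + 1)) = r + 1 by omega] at h
    have hl : ∀ a ∈ Ω, (∏ j ∈ Ω.erase a, (Polynomial.X + Polynomial.C (x j))).coeff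
        (#Ω - (r + 1)) = elemSymm x r (Ω.erase a) := by
      intro a ha
      have := card_erase_of_mem ha
      rw [Finset.prod_X_add_C_coeff _ _ (by omega), elemSymm]
      congr 2
      omega
    have hp : ∑ J ∈ powersetCard (r + 1) Ω, ∏ i ∈ J, s * x i =
        s ^ (r + 1) * elemSymm x (r + 1) Ω := by
      rw [elemSymm, mul_sum]
      refine sum_congr rfl fun J hJ => ?_
      rw [prod_mul_distrib, prod_const, (mem_powersetCard.1 hJ).2]
    rw [hp, sum_congr rfl fun a ha => by rw [hl a ha], ← elemSymm] at h
    apply mul_left_cancel₀ hs'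
    rw [mul_sum, ← mul_assoc, sInt, mul_neg_geom_sum, sub_mul, one_mul, ← h]
    exact sum_congr rfl fun a _ => by ring
  · rw [elemSymm_of_card_lt x (by omega), mul_zero]
    refine sum_eq_zero fun a ha => ?_
    have := card_erase_lt_of_mem ha
    rw [elemSymm_of_card_lt x (by omega), mul_zero, mul_zero]

theorem sum_hlCoeff_singleton {x : ι → F} {Ω : Finset ι} (hx : Set.InjOn x Ω)
    (hx0 : ∀ i ∈ Ω, x i ≠ 0) {s : F} (hs : s ≠ 1) :
    ∑ a ∈ Ω, hlCoeff x s {a} Ω = sInt s #Ω := by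
  rcases Ω.eq_empty_or_nonempty with rfl | hΩ
  · simp [sInt]
  have hc : #Ω - 1 + 1 = #Ω := Nat.sub_add_cancel hΩ.card_pos
  have h := sum_hlCoeff_mul_elemSymm_erase hx hs (#Ω - 1)
  rw [hc, elemSymm_card] at h
  apply mul_right_cancel₀ (prod_ne_zero_iff.2 hx0)
  rw [← h, sum_mul]
  refine sum_congr rfl fun a ha => ?_
  rw [← card_erase_of_mem ha, elemSymm_card, mul_prod_erase _ _ ha]

theorem sum_hlCoeff_mul_elemSymm_succ_erase {x : ι → F} {Ω : Finset ι} (hx : Set.InjOn x Ω)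
    (hx0 : ∀ i ∈ Ω, x i ≠ 0) {s : F} (hs : s ≠ 1) (r : ℕ) :
    ∑ a ∈ Ω, hlCoeff x s {a} Ω * elemSymm x (r + 1) (Ω.erase a) =
      (sInt s #Ω - sInt s (r + 1)) * elemSymm x (r + 1) Ω := by
  rw [sub_mul, ← sum_hlCoeff_mul_elemSymm_erase hx hs, ← sum_hlCoeff_singleton hx hx0 hs, sum_mul,
    ← sum_sub_distrib]
  refine sum_congr rfl fun a ha => ?_
  rw [elemSymm_succ_erase x r ha]
  ring

theorem hlCoeff_singleton_mul_hlCoeff (x : ι → F) (s : F) {a : ι} {I Ω : Finset ι} (ha : a ∈ I)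
    (hI : I ⊆ Ω) :
    hlCoeff x s {a} I * hlCoeff x s I Ω =
      hlCoeff x s {a} Ω * hlCoeff x s (I.erase a) (Ω.erase a) := by
  have h1 : Ω.erase a \ I.erase a = Ω \ I := by grind
  have h2 : Ω.erase a = I.erase a ∪ Ω \ I := by grind
  have h3 : Disjoint (I.erase a) (Ω \ I) := by
    rw [disjoint_left]; grind
  rw [hlCoeff_singleton, hlCoeff_singleton, hlCoeff, hlCoeff, h1, ← mul_prod_erase I _ ha, h2,
    prod_union h3]
  ring

theorem sInt_mul_sum_hlCoeff {x : ι → F} {Ω : Finset ι} (hx : Set.InjOn x Ω)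
    (hx0 : ∀ i ∈ Ω, x i ≠ 0) {s : F} (hs : s ≠ 1) (p : ℕ) (f : Finset ι → F) :
    sInt s (p + 1) * ∑ I ∈ powersetCard (p + 1) Ω, hlCoeff x s I Ω * f I =
      ∑ a ∈ Ω, hlCoeff x s {a} Ω *
        ∑ I ∈ powersetCard p (Ω.erase a), hlCoeff x s I (Ω.erase a) * f (insert a I) := by
  have hI : ∀ I ∈ powersetCard (p + 1) Ω, sInt s (p + 1) * (hlCoeff x s I Ω * f I) =
      ∑ a ∈ I, hlCoeff x s {a} Ω * (hlCoeff x s (I.erase a) (Ω.erase a) * f I) := by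
    intro I hI
    obtain ⟨hIΩ, hIc⟩ := mem_powersetCard.1 hI
    rw [← hIc, ← sum_hlCoeff_singleton (hx.mono (by exact_mod_cast hIΩ))
      (fun i hi => hx0 i (hIΩ hi)) hs, sum_mul]
    refine sum_congr rfl fun a ha => ?_
    rw [← mul_assoc, ← mul_assoc, hlCoeff_singleton_mul_hlCoeff x s ha hIΩ]
  simp_rw [mul_sum]
  rw [sum_congr rfl hI, sum_sigma', sum_sigma']
  refine sum_bij' (fun y _ => ⟨y.2, y.1.erase y.2⟩) (fun y _ => ⟨insert y.1 y.2, y.1⟩)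
    ?_ ?_ ?_ ?_ ?_
  · rintro ⟨I, a⟩ h
    simp only [mem_sigma, mem_powersetCard] at h ⊢
    exact ⟨h.1.1 h.2, erase_subset_erase _ h.1.1, by rw [card_erase_of_mem h.2]; omega⟩
  · rintro ⟨a, I⟩ h
    simp only [mem_sigma, mem_powersetCard] at h ⊢
    have ha : a ∉ I := fun h' => notMem_erase a Ω (h.2.1 h')
    exact ⟨⟨insert_subset h.1 (h.2.1.trans (erase_subset _ _)), by
      rw [card_insert_of_notMem ha, h.2.2]⟩, mem_insert_self _ _⟩
  · rintro ⟨I, a⟩ h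
    simp only [mem_sigma] at h
    simp [insert_erase h.2]
  · rintro ⟨a, I⟩ h
    simp only [mem_sigma, mem_powersetCard] at h
    have ha : a ∉ I := fun h' => notMem_erase a Ω (h.2.1 h')
    simp [erase_insert ha]
  · rintro ⟨I, a⟩ h
    simp only [mem_sigma] at h
    simp [insert_erase h.2]

theorem sum_hlCoeff_mul_elemSymm {x : ι → F} {s : F} (hs : s ≠ 1)
    (hs' : ∀ n, sInt s (n + 1) ≠ 0) (r j : ℕ) {Ω : Finset ι} (hx : Set.InjOn x Ω)
    (hx0 : ∀ i ∈ Ω, x i ≠ 0) :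
    ∑ I ∈ powersetCard (r + j) Ω, hlCoeff x s I Ω * elemSymm x r I =
      sChoose s (#Ω - r) j * elemSymm x r Ω := by
  induction hp : r + j generalizing r j Ω with
  | zero =>
    obtain ⟨rfl, rfl⟩ : r = 0 ∧ j = 0 := by omega
    simp [sChoose_zero_right hs', elemSymm_zero, hlCoeff]
  | succ p ih =>
    apply mul_left_cancel₀ (hs' p)
    rw [sInt_mul_sum_hlCoeff hx hx0 hs]
    have hxe : ∀ a, Set.InjOn x (Ω.erase a) := fun a => hx.mono (by simp)
    have hx0e : ∀ a, ∀ i ∈ Ω.erase a, x i ≠ 0 := fun a i hi => hx0 i (mem_of_mem_erase hi)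
    rcases r with _ | r
    · obtain rfl : j = p + 1 := by omega
      have hin : ∀ a ∈ Ω, ∑ I ∈ powersetCard p (Ω.erase a),
          hlCoeff x s I (Ω.erase a) * elemSymm x 0 (insert a I) = sChoose s (#Ω - 1) p := by
        intro a ha
        have := ih 0 p (hxe a) (hx0e a) (zero_add p)
        simp only [elemSymm_zero, mul_one, Nat.sub_zero, card_erase_of_mem ha] at this ⊢
        exact this
      rw [sum_congr rfl fun a ha => by rw [hin a ha], ← sum_mul,
        sum_hlCoeff_singleton hx hx0 hs, elemSymm_zero, mul_one, Nat.sub_zero]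
      rcases hc : #Ω with _ | M
      · simp [sInt, sChoose]
      · exact (sInt_mul_sChoose hs' M p).symm
    · obtain rfl : p = r + j := by omega
      rcases lt_or_ge #Ω (r + 1) with hr | hr
      · rw [elemSymm_of_card_lt x hr, mul_zero, mul_zero]
        refine sum_eq_zero fun a ha => ?_
        rw [powersetCard_eq_empty.2 (by have := card_erase_lt_of_mem ha; omega), sum_empty,
          mul_zero]
      obtain ⟨M, hM⟩ := Nat.exists_eq_add_of_le hr
      have hsplit : ∀ a ∈ Ω, ∑ I ∈ powersetCard (r + j) (Ω.erase a),
          hlCoeff x s I (Ω.erase a) * elemSymm x (r + 1) (insert a I) =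
            ∑ I ∈ powersetCard (r + j) (Ω.erase a),
              hlCoeff x s I (Ω.erase a) * elemSymm x (r + 1) I +
            x a * (sChoose s M j * elemSymm x r (Ω.erase a)) := by
        intro a ha
        have := ih r j (hxe a) (hx0e a) rfl
        rw [card_erase_of_mem ha, show #Ω - 1 - r = M by omega] at this
        rw [← this, mul_sum, ← sum_add_distrib]
        refine sum_congr rfl fun I hI => ?_
        rw [elemSymm_succ_insert x r fun h =>
          notMem_erase a Ω ((mem_powersetCard.1 hI).1 h)]
        ring
      have hM' : #Ω - (r + 1) = M := by omega
      rw [sum_congr rfl fun a ha => by rw [hsplit a ha]]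
      simp only [mul_add, sum_add_distrib]
      have hsecond : ∑ a ∈ Ω, hlCoeff x s {a} Ω *
          (x a * (sChoose s M j * elemSymm x r (Ω.erase a))) =
          sChoose s M j * (sInt s (r + 1) * elemSymm x (r + 1) Ω) := by
        rw [← sum_hlCoeff_mul_elemSymm_erase hx hs, mul_sum]
        exact sum_congr rfl fun a _ => by ring
      rw [hsecond, hM']
      rcases j with _ | j
      · have hz : ∀ a ∈ Ω, ∑ I ∈ powersetCard (r + 0) (Ω.erase a),
            hlCoeff x s I (Ω.erase a) * elemSymm x (r + 1) I = 0 := by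
          intro a _
          refine sum_eq_zero fun I hI => ?_
          rw [elemSymm_of_card_lt x (by have := (mem_powersetCard.1 hI).2; omega), mul_zero]
        rw [sum_eq_zero fun a ha => by rw [hz a ha, mul_zero]]
        simp only [add_zero]
        ring
      · have hfirst : ∀ a ∈ Ω, ∑ I ∈ powersetCard (r + (j + 1)) (Ω.erase a),
            hlCoeff x s I (Ω.erase a) * elemSymm x (r + 1) I =
            sChoose s (M - 1) j * elemSymm x (r + 1) (Ω.erase a) := by
          intro a ha
          have := ih (r + 1) j (hxe a) (hx0e a) (by omega)
          rwa [card_erase_of_mem ha, show #Ω - 1 - (r + 1) = M - 1 by omega] at this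
        have hfirst' : ∑ a ∈ Ω, hlCoeff x s {a} Ω *
            ∑ I ∈ powersetCard (r + (j + 1)) (Ω.erase a),
              hlCoeff x s I (Ω.erase a) * elemSymm x (r + 1) I =
            sChoose s (M - 1) j * ((sInt s #Ω - sInt s (r + 1)) * elemSymm x (r + 1) Ω) := by
          rw [← sum_hlCoeff_mul_elemSymm_succ_erase hx hx0 hs, mul_sum]
          refine sum_congr rfl fun a ha => ?_
          rw [hfirst a ha]
          ring
        rw [hfirst', hM, sInt_add, show r + (j + 1) + 1 = r + 1 + (j + 1) by omega,
          sInt_add s (r + 1) (j + 1)]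
        have habs : sInt s (j + 1) * sChoose s M (j + 1) = sInt s M * sChoose s (M - 1) j := by
          rcases M with _ | M
          · simp [sInt, sChoose]
          · exact sInt_mul_sChoose hs' M j
        linear_combination (- s ^ (r + 1) * elemSymm x (r + 1) Ω) * habs

theorem sum_prod_mul_sum_union (x : ι → F) (f : Finset ι → F) (r j : ℕ) (Ω : Finset ι) :
    ∑ J ∈ powersetCard r Ω, (∏ i ∈ J, x i) * ∑ J' ∈ powersetCard j (Ω \ J), f (J ∪ J') =
      ∑ I ∈ powersetCard (r + j) Ω, f I * elemSymm x r I := by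
  simp_rw [elemSymm, mul_sum]
  rw [sum_sigma', sum_sigma']
  refine sum_bij' (fun y _ => ⟨y.1 ∪ y.2, y.1⟩) (fun y _ => ⟨y.2, y.1 \ y.2⟩) ?_ ?_ ?_ ?_ ?_
  · rintro ⟨J, J'⟩ h
    simp only [mem_sigma, mem_powersetCard] at h ⊢
    obtain ⟨⟨h1, h2⟩, h3, h4⟩ := h
    have hd : Disjoint J J' := disjoint_sdiff.mono_right h3
    exact ⟨⟨union_subset h1 (h3.trans sdiff_subset), by rw [card_union_of_disjoint hd, h2, h4]⟩,
      subset_union_left, h2⟩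
  · rintro ⟨I, J⟩ h
    simp only [mem_sigma, mem_powersetCard] at h ⊢
    obtain ⟨⟨h1, h2⟩, h3, h4⟩ := h
    exact ⟨⟨h3.trans h1, h4⟩, sdiff_subset_sdiff h1 subset_rfl, by
      rw [card_sdiff_of_subset h3]; omega⟩
  · rintro ⟨J, J'⟩ h
    simp only [mem_sigma, mem_powersetCard] at h
    have hd : Disjoint J J' := disjoint_sdiff.mono_right h.2.1
    simp [union_sdiff_cancel_left hd]
  · rintro ⟨I, J⟩ h
    simp only [mem_sigma, mem_powersetCard] at h
    simp [union_sdiff_of_subset h.2.1]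
  · rintro ⟨J, J'⟩ _
    exact mul_comm _ _

end Symmetrization

theorem poch_inv_add {F : Type*} [Field F] {t : F} (ht : t ≠ 0) (Q : F) (a b : ℕ) :
    poch Q t⁻¹ (a + b) = poch Q t⁻¹ a * poch (t ^ (1 - ((a + b : ℕ) : ℤ)) * Q) t b := by
  rw [poch, prod_range_add, ← prod_range_reflect (fun i => 1 - Q * t⁻¹ ^ (a + i)), poch, poch]
  congr 1
  refine prod_congr rfl fun i hi => ?_
  have hi : i < b := mem_range.1 hi
  have : t⁻¹ ^ (a + (b - 1 - i)) = t ^ (1 - ((a + b : ℕ) : ℤ)) * t ^ i := by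
    rw [inv_pow, ← zpow_natCast, ← zpow_natCast, ← zpow_neg, ← zpow_add₀ ht]
    congr 1
    omega
  rw [this]
  ring

/-- The embedding of `ℚ[q, t]` into `K N`. -/
def qtEmb (N : ℕ) : MvPolynomial Bool ℚ →+* K N :=
  (algebraMap (Rx N) (K N)).comp (C.comp (algebraMap (MvPolynomial Bool ℚ) Fqt))

theorem qtEmb_injective (N : ℕ) : Function.Injective (qtEmb N) :=
  (IsFractionRing.injective (Rx N) (K N)).comp
    ((C_injective _ _).comp (IsFractionRing.injective (MvPolynomial Bool ℚ) Fqt))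

theorem qtEmb_X_true (N : ℕ) : qtEmb N (X true) = qK N := rfl

theorem qtEmb_X_false (N : ℕ) : qtEmb N (X false) = tK N := rfl

theorem qtEmb_ne_zero {N : ℕ} {p : MvPolynomial Bool ℚ} (h : p ≠ 0) : qtEmb N p ≠ 0 :=
  (map_ne_zero_iff _ (qtEmb_injective N)).2 h

theorem tK_ne_zero (N : ℕ) : tK N ≠ 0 := qtEmb_ne_zero (X_ne_zero false)

theorem tK_inv_ne_one (N : ℕ) : (tK N)⁻¹ ≠ 1 := by
  rw [Ne, inv_eq_one, ← qtEmb_X_false, ← map_one (qtEmb N), (qtEmb_injective N).eq_iff]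
  intro h
  simpa using congrArg (MvPolynomial.eval 0) h

theorem sInt_tK_inv_ne_zero (N n : ℕ) : sInt (tK N)⁻¹ (n + 1) ≠ 0 := by
  have hp : qtEmb N (∑ i ∈ range (n + 1), X false ^ i) ≠ 0 := by
    refine qtEmb_ne_zero fun h => ?_
    have := congrArg (MvPolynomial.eval 0) h
    simp [sum_range_succ'] at this
  have he : qtEmb N (∑ i ∈ range (n + 1), X false ^ i) = tK N ^ n * sInt (tK N)⁻¹ (n + 1) := by
    rw [map_sum, sInt, mul_sum, ← sum_range_reflect]
    refine sum_congr rfl fun i hi => ?_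
    have hi : i < n + 1 := mem_range.1 hi
    rw [map_pow, qtEmb_X_false, inv_pow, ← pow_sub₀ _ (tK_ne_zero N) (by omega)]
    congr 1
  exact right_ne_zero_of_mul (he ▸ hp)

theorem poch_qK_inv_ne_zero (N n : ℕ) : poch (qK N)⁻¹ (tK N)⁻¹ n ≠ 0 := by
  refine prod_ne_zero_iff.2 fun i _ h => ?_
  rw [sub_eq_zero, inv_pow, ← mul_inv, eq_comm, inv_eq_one, ← qtEmb_X_true, ← qtEmb_X_false,
    ← map_pow, ← map_mul, ← map_one (qtEmb N), (qtEmb_injective N).eq_iff] at h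
  simpa using congrArg (MvPolynomial.eval 0) h

theorem xK_injective (N : ℕ) : Function.Injective (xK : Fin N → K N) :=
  (IsFractionRing.injective (Rx N) (K N)).comp (X_injective)

theorem xK_ne_zero {N : ℕ} (i : Fin N) : xK i ≠ 0 :=
  (map_ne_zero_iff _ (IsFractionRing.injective (Rx N) (K N))).2 (X_ne_zero i)

theorem card_highSet {N ℓ : ℕ} (h : ℓ ≤ N) : #(highSet N ℓ) = N - ℓ := by
  have h1 := card_filter_add_card_filter_not (s := (univ : Finset (Fin N))) fun i => (i : ℕ) < ℓ
  have h2 : #(univ.filter fun i : Fin N => (i : ℕ) < ℓ) = ℓ := by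
    rw [Fin.card_filter_val_lt, min_eq_right h]
  rw [h2, card_univ, Fintype.card_fin] at h1
  simp only [not_lt] at h1
  rw [highSet]
  omega

/-!
Statement 1 (Lemma 4): with Ω = {1,…,N} ∖ {1,…,ℓ},
  ∑_{m'=0}^{N−k−ℓ+n} (q^{-m'}/(t^{k−N+1}q^{-1};t)_{m'+ℓ−n})
      ∑_{J⊆Ω, |J|=k−n} x_J ∑_{J'⊆Ω∖J, |J'|=m'} Ã_{J∪J'}^Ω
    = (1/(q^{-1};t^{-1})_{N−k}) ∑_{J⊆Ω, |J|=k−n} x_J.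
-/

theorem stmt1 (N k ℓ n : ℕ) (h1 : n ≤ ℓ) (h2 : ℓ ≤ N) (h3 : n ≤ k) (h4 : k - n ≤ N - ℓ) :
    ∑ m' ∈ Finset.range (N + n - k - ℓ + 1),
      (qK N)⁻¹ ^ m' / poch ((tK N) ^ ((k : ℤ) - N + 1) * (qK N)⁻¹) (tK N) (m' + (ℓ - n)) *
        ∑ J ∈ powersetCard (k - n) (highSet N ℓ),
          xProd J * ∑ J' ∈ powersetCard m' (highSet N ℓ \ J), Atilde (J ∪ J') (highSet N ℓ)
    = (poch (qK N)⁻¹ (tK N)⁻¹ (N - k))⁻¹ *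
        ∑ J ∈ powersetCard (k - n) (highSet N ℓ), xProd J := by
  have hpoch : ∀ m' ∈ range (N + n - k - ℓ + 1), (qK N)⁻¹ ^ m' /
      poch ((tK N) ^ ((k : ℤ) - N + 1) * (qK N)⁻¹) (tK N) (m' + (ℓ - n)) =
      (poch (qK N)⁻¹ (tK N)⁻¹ (N - k))⁻¹ *
        ((qK N)⁻¹ ^ m' * poch (qK N)⁻¹ (tK N)⁻¹ (N + n - k - ℓ - m')) := by
    intro m' hm
    have hm : m' < N + n - k - ℓ + 1 := mem_range.1 hm
    have h := poch_inv_add (tK_ne_zero N) (qK N)⁻¹ (N + n - k - ℓ - m') (m' + (ℓ - n))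
    have hne := poch_qK_inv_ne_zero N (N - k)
    rw [show N + n - k - ℓ - m' + (m' + (ℓ - n)) = N - k by omega,
      show 1 - ((N - k : ℕ) : ℤ) = (k : ℤ) - N + 1 by omega] at h
    rw [h] at hne ⊢
    have hl := left_ne_zero_of_mul hne
    rw [mul_inv, div_eq_mul_inv]
    linear_combination (-(qK N)⁻¹ ^ m' *
      (poch ((tK N) ^ ((k : ℤ) - N + 1) * (qK N)⁻¹) (tK N) (m' + (ℓ - n)))⁻¹) *
        inv_mul_cancel₀ hl
  have hinner : ∀ m', ∑ J ∈ powersetCard (k - n) (highSet N ℓ),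
      xProd J * ∑ J' ∈ powersetCard m' (highSet N ℓ \ J), Atilde (J ∪ J') (highSet N ℓ) =
      sChoose (tK N)⁻¹ (N + n - k - ℓ) m' *
        ∑ J ∈ powersetCard (k - n) (highSet N ℓ), xProd J := by
    intro m'
    have h := sum_hlCoeff_mul_elemSymm (tK_inv_ne_one N) (sInt_tK_inv_ne_zero N) (k - n) m'
      (Ω := highSet N ℓ) (xK_injective N).injOn (fun i _ => xK_ne_zero i)
    rw [← sum_prod_mul_sum_union, card_highSet h2,
      show N - ℓ - (k - n) = N + n - k - ℓ by omega] at h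
    exact h
  rw [sum_congr rfl fun m' hm => by rw [hpoch m' hm, hinner m']]
  have h := sum_pow_mul_poch_mul_sChoose (sInt_tK_inv_ne_zero N) (qK N)⁻¹ (N + n - k - ℓ)
  conv_rhs => rw [← one_mul (∑ J ∈ _, xProd J), ← h, sum_mul, mul_sum]
  exact sum_congr rfl fun m' _ => by ring

end
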